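/- arXiv:1701.00346 — 2 statements merged into one kernel-verified Lean document; each statement's English description precedes it below -/
import Mathlib

section
/- Let t > 1 be a real number, s ≥ 1 an integer, let n ≥ 1 and 1 ≤ n1 ≤ n be integers, set λ_{N'} := M_{n1,n1−2N'}(t) · M_{2n−n1,n1−2N'}(t) / M_{2n,0}(t) for 0 ≤ N' ≤ ⌊n1/2⌋, and define the entanglement entropy S_{n1}(s,t) := Σ_{N'=0}^{⌊n1/2⌋} λ_{N'} [ (n1 − 2N') log s − log λ_{N'} ]. Then n1 log s + D1(s,t) ≤ S_{n1}(s,t) < n1 log s + D2(t) + D3(t), where D1(s,t) := −2 C(t)² log s · Σ_{N'=0}^∞ N' t^{−2N'²}, D2(t) := log[Σ_{M'=0}^∞ t^{−2M'²}], and D3(t) := 2 C(t)² log t · Σ_{N'=0}^∞ N'² t^{−2N'²}. -/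
noncomputable section

open Finset

/-- Height of the path `w` (of length `L`, up = `true`, down = `false`) after `i` steps. -/
def height {L : ℕ} (w : Fin L → Bool) (i : ℕ) : ℤ :=
  ∑ j ∈ Finset.univ.filter (fun j : Fin L => (j : ℕ) < i),
    (if w j then (1 : ℤ) else -1)

/-- `DyckSet a b`: the set `D_{a,b}` of paths of length `2a+b` with `a+b` up steps whose
heights stay nonnegative. -/
def DyckSet (a b : ℕ) : Finset (Fin (2 * a + b) → Bool) :=
  Finset.univ.filter (fun w =>
    (Finset.univ.filter (fun j => w j = true)).card = a + b ∧
      ∀ i ≤ 2 * a + b, 0 ≤ height w i)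

/-- The area `A(w)` between the path `w` and the x-axis. -/
def area {L : ℕ} (w : Fin L → Bool) : ℝ :=
  (∑ i ∈ Finset.range L, ((height w i + height w (i + 1) : ℤ) : ℝ)) / 2

/-- The weighted path sum `M_{2a+b,b}(t) = Σ_{w ∈ D_{a,b}} t^{A(w)}`. -/
def M (a b : ℕ) (t : ℝ) : ℝ := ∑ w ∈ DyckSet a b, t ^ area w

/-- `M_{ℓ,m}(t)` for `ℓ ≥ m` with `ℓ - m` even. -/
def Mlm (ℓ m : ℕ) (t : ℝ) : ℝ := M ((ℓ - m) / 2) m t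

/-- `P k`: the number of partitions of `k`. -/
def P (k : ℕ) : ℕ := Fintype.card (Nat.Partition k)

/-- `C(t) = Σ_{k=0}^∞ P(k) t^{-2k}`. -/
def C (t : ℝ) : ℝ := ∑' k : ℕ, (P k : ℝ) * t ^ (-(2 : ℝ) * k)

open Real

/-- Weighted sum over all nonnegative paths of length `L` ending at height `m`. -/
def pathSum (t : ℝ) (L : ℕ) (m : ℤ) : ℝ :=
  ∑ w : Fin L → Bool with ((∀ i ≤ L, 0 ≤ height w i) ∧ height w L = m), t ^ area w

lemma height_snoc_of_le {L : ℕ} (w : Fin L → Bool) (b : Bool) {i : ℕ} (hi : i ≤ L) :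
    height (Fin.snoc w b : Fin (L + 1) → Bool) i = height w i := by
  have h : ¬ L < i := by omega
  unfold height
  rw [sum_filter, sum_filter, Fin.sum_univ_castSucc]
  simp [h]

lemma height_snoc_last {L : ℕ} (w : Fin L → Bool) (b : Bool) :
    height (Fin.snoc w b : Fin (L + 1) → Bool) (L + 1) =
      height w L + (if b then 1 else -1) := by
  unfold height
  rw [sum_filter, sum_filter, Fin.sum_univ_castSucc]
  have h (x : Fin L) : (x : ℕ) < L + 1 := by omega
  simp [h]

lemma area_snoc {L : ℕ} (w : Fin L → Bool) (b : Bool) :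
    area (Fin.snoc w b : Fin (L + 1) → Bool) =
      area w + height w L + (if b then 1 / 2 else -(1 / 2)) := by
  unfold area
  rw [sum_range_succ, height_snoc_last, height_snoc_of_le w b le_rfl]
  rw [sum_congr rfl fun i hi => by
    rw [height_snoc_of_le w b (mem_range.1 hi).le,
      height_snoc_of_le w b (Nat.succ_le_of_lt (mem_range.1 hi))]]
  split_ifs <;> push_cast <;> ring

lemma pathSum_nonneg {t : ℝ} (ht : 0 < t) (L : ℕ) (m : ℤ) : 0 ≤ pathSum t L m :=
  sum_nonneg fun _ _ => (rpow_pos_of_pos ht _).le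

lemma pathSum_of_neg (t : ℝ) (L : ℕ) {m : ℤ} (hm : m < 0) : pathSum t L m = 0 := by
  unfold pathSum
  rw [filter_false_of_mem, sum_empty]
  rintro w - ⟨h1, h2⟩
  have := h1 L le_rfl
  omega

lemma pathSum_zero (t : ℝ) (m : ℤ) : pathSum t 0 m = if m = 0 then 1 else 0 := by
  unfold pathSum
  rw [sum_filter]
  simp [height, area, eq_comm (a := m)]

lemma pathSum_succ {t : ℝ} (ht : 0 < t) (L : ℕ) {m : ℤ} (hm : 0 ≤ m) :
    pathSum t (L + 1) m = t ^ ((m : ℝ) - 1 / 2) * pathSum t L (m - 1) +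
      t ^ ((m : ℝ) + 1 / 2) * pathSum t L (m + 1) := by
  have key (w : Fin L → Bool) (b : Bool) :
      ((∀ i ≤ L + 1, 0 ≤ height (Fin.snoc w b : Fin (L + 1) → Bool) i) ∧
        height (Fin.snoc w b : Fin (L + 1) → Bool) (L + 1) = m) ↔
      ((∀ i ≤ L, 0 ≤ height w i) ∧ height w L = m - (if b then 1 else -1)) := by
    rw [height_snoc_last, eq_sub_iff_add_eq]
    refine and_congr_left fun h => ⟨fun h1 i hi => ?_, fun h1 i hi => ?_⟩
    · rw [← height_snoc_of_le w b hi]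
      exact h1 i (by omega)
    · rcases Nat.le_succ_iff.1 hi with hi | rfl
      · rw [height_snoc_of_le w b hi]
        exact h1 i hi
      · rw [height_snoc_last, h]
        exact hm
  unfold pathSum
  rw [sum_filter, ← (Fin.snocEquiv (fun _ : Fin (L + 1) => Bool)).sum_comp,
    Fintype.sum_prod_type, Fintype.sum_bool, mul_sum, mul_sum, sum_filter, sum_filter]
  congr 1
  all_goals
    refine sum_congr rfl fun w _ => ?_
    refine (if_congr (key w _) rfl rfl).trans ?_
    simp only [if_true, Bool.false_eq_true, if_false, sub_neg_eq_add]
    refine if_ctx_congr Iff.rfl (fun h => ?_) (fun _ => rfl)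
    rw [← rpow_add ht]
    congr 1
    refine (area_snoc w _).trans ?_
    rw [h.2]
    push_cast
    simp
    ring

lemma pathSum_of_lt {t : ℝ} (ht : 0 < t) (L : ℕ) :
    ∀ {m : ℤ}, (L : ℤ) < m → pathSum t L m = 0 := by
  induction L with
  | zero => intro m hm; rw [pathSum_zero, if_neg (by simp at hm; omega)]
  | succ L ih =>
    intro m hm
    push_cast at hm
    rw [pathSum_succ ht L (by omega), ih (by omega), ih (by omega)]
    simp

lemma pathSum_of_odd {t : ℝ} (ht : 0 < t) (L : ℕ) :
    ∀ {m : ℤ}, Odd (L - m) → pathSum t L m = 0 := by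
  induction L with
  | zero =>
    intro m hm
    rw [pathSum_zero, if_neg]
    rintro rfl
    simp at hm
  | succ L ih =>
    intro m hm
    rcases lt_or_ge m 0 with h | h
    · exact pathSum_of_neg t _ h
    · push_cast at hm
      rw [pathSum_succ ht L h, ih (by grind), ih (by grind)]
      simp

/-- Splitting off one step of the left factor in the pairing of left and right path sums. -/
lemma sum_pathSum_succ_mul {t : ℝ} (ht : 0 < t) (k l K : ℕ) (hl : l ≤ K) :
    ∑ m ∈ range (K + 1), pathSum t (k + 1) m * pathSum t l m =
      ∑ m ∈ range (K + 1), t ^ ((m : ℝ) + 1 / 2) * pathSum t k m * pathSum t l (m + 1) +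
      ∑ m ∈ range (K + 1), t ^ ((m : ℝ) + 1 / 2) * pathSum t k (m + 1) * pathSum t l m := by
  have h (m : ℕ) : pathSum t (k + 1) m * pathSum t l m =
      t ^ ((m : ℝ) - 1 / 2) * pathSum t k (m - 1) * pathSum t l m +
      t ^ ((m : ℝ) + 1 / 2) * pathSum t k (m + 1) * pathSum t l m := by
    rw [pathSum_succ ht k (by positivity)]
    push_cast
    ring
  simp_rw [h]
  rw [sum_add_distrib]
  congr 1
  rw [sum_range_succ', sum_range_succ _ K]
  rw [pathSum_of_neg t k (by simp), pathSum_of_lt ht l (m := K + 1) (by omega)]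
  simp only [mul_zero, zero_mul]
  congr 1
  refine sum_congr rfl fun m _ => ?_
  push_cast
  rw [add_sub_cancel_right]
  congr 3
  ring

lemma sum_pathSum_mul {t : ℝ} (ht : 0 < t) (k l K : ℕ) (hK : k + l ≤ K) :
    ∑ m ∈ range (K + 1), pathSum t k m * pathSum t l m = pathSum t (k + l) 0 := by
  induction k generalizing l with
  | zero =>
    rw [sum_eq_single 0]
    · simp [pathSum_zero]
    · intro m _ hm
      simp [pathSum_zero, hm]
    · simp
  | succ k ih =>
    rw [Nat.add_right_comm, Nat.add_assoc, ← ih (l + 1) (by omega),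
      sum_pathSum_succ_mul ht k l K (by omega)]
    simp_rw [mul_comm (pathSum t k _) (pathSum t (l + 1) _)]
    rw [sum_pathSum_succ_mul ht l k K (by omega), add_comm]
    congr 1 <;> exact sum_congr rfl fun m _ => by ring

lemma height_eq_card {L : ℕ} (w : Fin L → Bool) :
    height w L = 2 * #{j | w j = true} - L := by
  have h : #{j | w j = true} + #{j | ¬ w j = true} = L := by
    simpa using card_filter_add_card_filter_not (s := (univ : Finset (Fin L))) (fun j => w j = true)
  unfold height
  rw [filter_true_of_mem (fun j _ => j.2), sum_ite]
  simp only [sum_const, nsmul_eq_mul]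
  lia

lemma M_eq_pathSum (a b : ℕ) (t : ℝ) : M a b t = pathSum t (2 * a + b) b := by
  unfold M pathSum DyckSet
  refine sum_congr (filter_congr fun w _ => ?_) fun _ _ => rfl
  rw [and_comm, height_eq_card]
  refine and_congr_right fun _ => ?_
  push_cast
  omega

lemma Mlm_eq_pathSum {ℓ m : ℕ} (hm : m ≤ ℓ) (h : Even (ℓ - m)) (t : ℝ) :
    Mlm ℓ m t = pathSum t ℓ m := by
  unfold Mlm
  rw [M_eq_pathSum]
  congr 1
  have := Nat.two_mul_div_two_of_even h
  omega

lemma sum_Mlm_mul {t : ℝ} (ht : 0 < t) {k l : ℕ} (hkl : k ≤ l) (h : Even (l - k)) :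
    ∑ N ∈ range (k / 2 + 1), Mlm k (k - 2 * N) t * Mlm l (k - 2 * N) t = Mlm (k + l) 0 t := by
  rw [Mlm_eq_pathSum (Nat.zero_le _) (by grind), Nat.cast_zero,
    ← sum_pathSum_mul ht k l (k + l) le_rfl]
  refine sum_of_injOn (fun N => k - 2 * N) ?_ ?_ ?_ ?_
  · intro a ha b hb hab
    simp at ha hb hab
    omega
  · intro a ha
    simp
    omega
  · intro m hm hm'
    rw [mul_eq_zero]
    left
    rcases lt_or_ge k m with hlt | hge
    · exact pathSum_of_lt ht k (by omega)
    · refine pathSum_of_odd ht k ?_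
      by_contra hodd
      rw [Int.not_odd_iff_even] at hodd
      obtain ⟨r, hr⟩ := hodd
      refine hm' ⟨r.toNat, ?_, ?_⟩
      · simp
        omega
      · simp
        omega
  · intro N hN
    have hN : 2 * N ≤ k := by simp at hN; omega
    rw [Mlm_eq_pathSum (by omega) (by grind), Mlm_eq_pathSum (by omega) (by grind)]

lemma card_restricted_of_lt {d k : ℕ} (h : k < d + 1) :
    #(Nat.Partition.restricted k (· ≤ d + 1)) = #(Nat.Partition.restricted k (· ≤ d)) := by
  congr 1
  refine filter_congr fun p _ => ⟨fun _ i hi => ?_, fun hp i hi => (hp i hi).trans d.le_succ⟩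
  have := Nat.Partition.le_of_mem_parts hi
  omega

lemma card_restricted_add (d k : ℕ) :
    #(Nat.Partition.restricted (k + (d + 1)) (· ≤ d + 1)) =
      #(Nat.Partition.restricted (k + (d + 1)) (· ≤ d)) +
        #(Nat.Partition.restricted k (· ≤ d + 1)) := by
  rw [← card_filter_add_card_filter_not
    (s := Nat.Partition.restricted (k + (d + 1)) (· ≤ d + 1)) (fun p => d + 1 ∉ p.parts)]
  congr 1
  · congr 1
    ext p
    simp only [Nat.Partition.restricted, mem_filter, mem_univ, true_and]
    refine ⟨fun ⟨h1, h2⟩ i hi => ?_, fun h1 => ⟨fun i hi => (h1 i hi).trans d.le_succ,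
      fun hd => absurd (h1 _ hd) (by omega)⟩⟩
    exact Nat.lt_succ_iff.1 (lt_of_le_of_ne (h1 i hi) (by rintro rfl; exact h2 hi))
  · symm
    refine card_bij (fun p hp => ⟨(d + 1) ::ₘ p.parts, ?_, ?_⟩) ?_ ?_ ?_
    · intro i hi
      rcases Multiset.mem_cons.1 hi with rfl | hi
      · omega
      · exact p.parts_pos hi
    · rw [Multiset.sum_cons, p.parts_sum, add_comm]
    · intro p hp
      simp only [Nat.Partition.restricted, mem_filter, mem_univ, true_and] at hp ⊢
      simpa using hp
    · intro p _ p' _ h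
      ext1
      simpa using h
    · intro p hp
      simp only [Nat.Partition.restricted, mem_filter, mem_univ, true_and, not_not] at hp
      have hcons := Multiset.cons_erase hp.2
      refine ⟨⟨p.parts.erase (d + 1), fun hi => p.parts_pos (Multiset.mem_of_mem_erase hi), ?_⟩,
        ?_, ?_⟩
      · have := congrArg Multiset.sum hcons
        rw [Multiset.sum_cons, p.parts_sum] at this
        omega
      · simp only [Nat.Partition.restricted, mem_filter, mem_univ, true_and]
        exact fun i hi => hp.1 i (Multiset.mem_of_mem_erase hi)
      · ext1
        exact hcons

/-- If `a` satisfies `a = b + (a delayed by m)`, its generating function is that of `b` divided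
by `1 - q ^ m`. -/
lemma hasSum_mul_pow_of_delay {a b : ℕ → ℝ} {q B : ℝ} {m : ℕ} (hm : m ≠ 0) (hq : 0 ≤ q)
    (hq1 : q < 1) (ha : ∀ k, 0 ≤ a k) (hb : ∀ k, 0 ≤ b k) (hab : ∀ k < m, a k = b k)
    (hrec : ∀ k, a (k + m) = b (k + m) + a k) (hB : HasSum (fun k => b k * q ^ k) B) :
    HasSum (fun k => a k * q ^ k) (B * (1 - q ^ m)⁻¹) := by
  have hqm : 0 < 1 - q ^ m := sub_pos.2 (pow_lt_one₀ hq hq1 hm)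
  have ha' (k : ℕ) : 0 ≤ a k * q ^ k := mul_nonneg (ha k) (pow_nonneg hq k)
  have hsplit (N : ℕ) : ∑ k ∈ range (m + N), a k * q ^ k =
      ∑ k ∈ range (m + N), b k * q ^ k + q ^ m * ∑ k ∈ range N, a k * q ^ k := by
    rw [sum_range_add, sum_range_add, add_assoc, mul_sum, ← sum_add_distrib]
    congr 1
    · exact sum_congr rfl fun k hk => by rw [hab k (mem_range.1 hk)]
    · refine sum_congr rfl fun k _ => ?_
      rw [add_comm m k, hrec]
      ring
  have hs : Summable fun k => a k * q ^ k := by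
    refine summable_of_sum_range_le (c := B * (1 - q ^ m)⁻¹) ha' fun N => ?_
    rw [← div_eq_mul_inv, le_div_iff₀ hqm]
    have h1 : ∑ k ∈ range N, a k * q ^ k ≤ ∑ k ∈ range (m + N), a k * q ^ k :=
      sum_le_sum_of_subset_of_nonneg (range_subset_range.2 (by omega)) fun k _ _ => ha' k
    have h2 : ∑ k ∈ range (m + N), b k * q ^ k ≤ B :=
      sum_le_hasSum _ (fun k _ => mul_nonneg (hb k) (pow_nonneg hq k)) hB
    rw [hsplit] at h1
    linarith
  have hlim := hs.hasSum.tendsto_sum_nat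
  have hlim' := ((hB.tendsto_sum_nat).comp (Filter.tendsto_add_atTop_nat m)).add
    (hlim.const_mul (q ^ m))
  have heq := tendsto_nhds_unique (hlim.comp (Filter.tendsto_add_atTop_nat m))
    (hlim'.congr fun N => by
      simp only [Function.comp_apply]
      rw [add_comm N m, hsplit])
  have : ∑' k, a k * q ^ k = B * (1 - q ^ m)⁻¹ := by
    rw [← div_eq_mul_inv, eq_div_iff hqm.ne']
    linarith
  exact this ▸ hs.hasSum

lemma hasSum_card_restricted {q : ℝ} (hq : 0 ≤ q) (hq1 : q < 1) (d : ℕ) :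
    HasSum (fun k => (#(Nat.Partition.restricted k (· ≤ d)) : ℝ) * q ^ k)
      (∏ i ∈ range d, (1 - q ^ (i + 1))⁻¹) := by
  induction d with
  | zero =>
    convert! hasSum_single (f := fun k => (#(Nat.Partition.restricted k (· ≤ 0)) : ℝ) * q ^ k)
      0 ?_
    · simp [Nat.Partition.restricted]
    · intro k hk
      rw [mul_eq_zero, Nat.cast_eq_zero, card_eq_zero]
      left
      refine filter_false_of_mem fun p _ hp => hk ?_
      rw [← p.parts_sum]
      exact Multiset.sum_eq_zero fun i hi => Nat.le_zero.1 (hp i hi)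
  | succ d ih =>
    rw [prod_range_succ]
    refine hasSum_mul_pow_of_delay d.succ_ne_zero hq hq1 (fun _ => Nat.cast_nonneg _)
      (fun _ => Nat.cast_nonneg _) (fun k hk => ?_) (fun k => ?_) ih
    · rw [card_restricted_of_lt hk]
    · rw [card_restricted_add, Nat.cast_add]

lemma prod_inv_one_sub_pow_le {q : ℝ} (hq : 0 ≤ q) (hq1 : q < 1) (d : ℕ) :
    ∏ i ∈ range d, (1 - q ^ (i + 1))⁻¹ ≤ exp ((1 - q)⁻¹ * (1 - q)⁻¹) := by
  have h1q : 0 < 1 - q := sub_pos.2 hq1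
  calc ∏ i ∈ range d, (1 - q ^ (i + 1))⁻¹ ≤ ∏ i ∈ range d, exp (q ^ i * (1 - q)⁻¹) := by
        refine prod_le_prod (fun i _ => ?_) fun i _ => ?_
        · exact inv_nonneg.2 (sub_nonneg.2 (pow_le_one₀ hq hq1.le))
        · have hpow : q ^ (i + 1) ≤ q := pow_le_of_le_one hq hq1.le i.succ_ne_zero
          have hpow' : q ^ (i + 1) ≤ q ^ i := pow_le_pow_of_le_one hq hq1.le i.le_succ
          have hpos : 0 < 1 - q ^ (i + 1) := by linarith
          refine le_trans ?_ (add_one_le_exp _)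
          have h : (1 - q ^ (i + 1))⁻¹ = q ^ (i + 1) * (1 - q ^ (i + 1))⁻¹ + 1 := by
            field_simp
            ring
          rw [h]
          gcongr
    _ = exp ((∑ i ∈ range d, q ^ i) * (1 - q)⁻¹) := by rw [← exp_sum, sum_mul]
    _ ≤ exp ((1 - q)⁻¹ * (1 - q)⁻¹) := by
        gcongr
        exact sum_le_hasSum _ (fun i _ => pow_nonneg hq i) (hasSum_geometric_of_lt_one hq hq1)

lemma summable_card_partition_mul_pow {q : ℝ} (hq : 0 ≤ q) (hq1 : q < 1) :
    Summable fun k => (P k : ℝ) * q ^ k := by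
  refine summable_of_sum_range_le (fun k => mul_nonneg (Nat.cast_nonneg _) (pow_nonneg hq k))
    fun N => le_trans ?_ (prod_inv_one_sub_pow_le hq hq1 N)
  refine le_trans (sum_le_sum fun k hk => ?_) (sum_le_hasSum (range N)
    (fun k _ => mul_nonneg (Nat.cast_nonneg _) (pow_nonneg hq k)) (hasSum_card_restricted hq hq1 N))
  rw [Nat.Partition.restricted, filter_true_of_mem, card_univ, P]
  exact fun p _ i hi => (Nat.Partition.le_of_mem_parts hi).trans (mem_range.1 hk).le

lemma prod_inv_le_tsum_card_partition {q : ℝ} (hq : 0 ≤ q) (hq1 : q < 1) (d : ℕ) :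
    ∏ i ∈ range d, (1 - q ^ (i + 1))⁻¹ ≤ ∑' k, (P k : ℝ) * q ^ k := by
  refine hasSum_le (fun k => ?_) (hasSum_card_restricted hq hq1 d)
    (summable_card_partition_mul_pow hq hq1).hasSum
  gcongr
  exact card_le_univ _

lemma rpow_neg_two_mul {t : ℝ} (ht : 0 < t) (k : ℕ) :
    t ^ (-(2 : ℝ) * k) = (t ^ (-(2 : ℝ))) ^ k := by
  rw [rpow_mul ht.le, rpow_natCast]

lemma rpow_neg_two_lt_one {t : ℝ} (ht : 1 < t) : t ^ (-(2 : ℝ)) < 1 :=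
  rpow_lt_one_of_one_lt_of_neg ht (by norm_num)

lemma prod_inv_le_C {t : ℝ} (ht : 1 < t) (d : ℕ) :
    ∏ i ∈ range d, (1 - (t ^ (-(2 : ℝ))) ^ (i + 1))⁻¹ ≤ C t := by
  have ht0 : 0 < t := by linarith
  unfold C
  simp_rw [rpow_neg_two_mul ht0]
  exact prod_inv_le_tsum_card_partition (rpow_nonneg ht0.le _) (rpow_neg_two_lt_one ht) d

/-- The `q`-binomial upper bound for the path sum with `u` up steps and `d` down steps. -/
lemma pathSum_le_prod {t : ℝ} (ht : 1 < t) (L : ℕ) : ∀ u d : ℕ, u + d = L →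
    pathSum t L ((u : ℤ) - d) ≤ t ^ ((u : ℝ) ^ 2 - ((u : ℝ) - d) ^ 2 / 2) *
      ∏ i ∈ range d, (1 - (t ^ (-(2 : ℝ))) ^ (i + 1))⁻¹ := by
  have ht0 : 0 < t := by linarith
  have hq0 : 0 < t ^ (-(2 : ℝ)) := rpow_pos_of_pos ht0 _
  have hpos (i : ℕ) : 0 < 1 - (t ^ (-(2 : ℝ))) ^ (i + 1) :=
    sub_pos.2 (pow_lt_one₀ hq0.le (rpow_neg_two_lt_one ht) i.succ_ne_zero)
  have hprod (d : ℕ) : 0 < ∏ i ∈ range d, (1 - (t ^ (-(2 : ℝ))) ^ (i + 1))⁻¹ :=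
    prod_pos fun i _ => inv_pos.2 (hpos i)
  induction L with
  | zero =>
    intro u d h
    obtain ⟨rfl, rfl⟩ : u = 0 ∧ d = 0 := by omega
    simp [pathSum_zero]
  | succ L ih =>
    intro u d h
    rcases lt_or_ge ((u : ℤ) - d) 0 with hm | hm
    · rw [pathSum_of_neg t _ hm]
      exact mul_nonneg (rpow_nonneg ht0.le _) (hprod d).le
    obtain ⟨u, rfl⟩ : ∃ v, u = v + 1 := ⟨u - 1, by omega⟩
    rw [pathSum_succ ht0 L hm]
    have hup : t ^ ((((u + 1 : ℕ) : ℤ) - d : ℤ) - 1 / 2 : ℝ) *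
        pathSum t L (((u + 1 : ℕ) : ℤ) - d - 1) ≤
        t ^ (((u + 1 : ℕ) : ℝ) ^ 2 - (((u + 1 : ℕ) : ℝ) - d) ^ 2 / 2) *
          ((t ^ (-(2 : ℝ))) ^ d * ∏ i ∈ range d, (1 - (t ^ (-(2 : ℝ))) ^ (i + 1))⁻¹) := by
      have := ih u d (by omega)
      rw [show (((u + 1 : ℕ) : ℤ) - d - 1) = (u : ℤ) - d by push_cast; ring]
      refine (mul_le_mul_of_nonneg_left this (rpow_nonneg ht0.le _)).trans_eq ?_
      rw [← mul_assoc, ← mul_assoc, ← rpow_neg_two_mul ht0, ← rpow_add ht0, ← rpow_add ht0]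
      congr 2
      push_cast
      ring
    rcases d with - | d
    · rw [pathSum_of_lt ht0 L (m := _ + 1) (by push_cast; omega)]
      simpa using hup
    have hdown : t ^ ((((u + 1 : ℕ) : ℤ) - (d + 1 : ℕ) : ℤ) + 1 / 2 : ℝ) *
        pathSum t L (((u + 1 : ℕ) : ℤ) - (d + 1 : ℕ) + 1) ≤
        t ^ (((u + 1 : ℕ) : ℝ) ^ 2 - (((u + 1 : ℕ) : ℝ) - (d + 1 : ℕ)) ^ 2 / 2) *
          ∏ i ∈ range d, (1 - (t ^ (-(2 : ℝ))) ^ (i + 1))⁻¹ := by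
      have := ih (u + 1) d (by omega)
      rw [show (((u + 1 : ℕ) : ℤ) - (d + 1 : ℕ) + 1) = ((u + 1 : ℕ) : ℤ) - d by push_cast; ring]
      refine (mul_le_mul_of_nonneg_left this (rpow_nonneg ht0.le _)).trans_eq ?_
      rw [← mul_assoc, ← rpow_add ht0]
      congr 2
      push_cast
      ring
    refine (add_le_add hup hdown).trans_eq ?_
    rw [← mul_add, prod_range_succ]
    congr 1
    have := (hpos d).ne'
    field_simp
    ring

lemma pathSum_le_C {t : ℝ} (ht : 1 < t) (u d : ℕ) :
    pathSum t (u + d) ((u : ℤ) - d) ≤ t ^ ((u : ℝ) ^ 2 - ((u : ℝ) - d) ^ 2 / 2) * C t :=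
  (pathSum_le_prod ht _ u d rfl).trans
    (mul_le_mul_of_nonneg_left (prod_inv_le_C ht d) (rpow_nonneg (by linarith) _))

/-- The path of `u` up steps followed by `d` down steps bounds the path sum below. -/
lemma rpow_le_pathSum {t : ℝ} (ht : 0 < t) (u d : ℕ) (h : d ≤ u) :
    t ^ ((u : ℝ) ^ 2 - ((u : ℝ) - d) ^ 2 / 2) ≤ pathSum t (u + d) ((u : ℤ) - d) := by
  induction d with
  | zero =>
    clear h
    induction u with
    | zero => simp [pathSum_zero]
    | succ u ih =>
      have h1 := mul_le_mul_of_nonneg_left ih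
        (rpow_nonneg ht.le ((((u + 1 : ℕ) : ℤ) : ℝ) - 1 / 2))
      rw [← rpow_add ht] at h1
      rw [Nat.cast_zero, sub_zero, add_zero, pathSum_succ ht u (by omega)]
      refine le_add_of_le_of_nonneg (le_trans (le_of_eq ?_) (h1.trans_eq ?_))
        (mul_nonneg (rpow_nonneg ht.le _) (pathSum_nonneg ht _ _))
      · congr 1
        push_cast
        ring
      · congr 2
        push_cast
        ring
  | succ d ih =>
    have h1 := mul_le_mul_of_nonneg_left (ih (by omega))
      (rpow_nonneg ht.le ((((u : ℤ) - (d + 1 : ℕ) : ℤ) : ℝ) + 1 / 2))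
    rw [← rpow_add ht] at h1
    rw [← add_assoc, pathSum_succ ht (u + d) (by omega)]
    refine le_add_of_nonneg_of_le (mul_nonneg (rpow_nonneg ht.le _) (pathSum_nonneg ht _ _))
      (le_trans (le_of_eq ?_) (h1.trans_eq ?_))
    · congr 1
      push_cast
      ring
    · congr 2
      push_cast
      ring

lemma Mlm_mul_div_le {t : ℝ} (ht : 1 < t) {n k N : ℕ} (hk : k ≤ n) (hN : 2 * N ≤ k) :
    Mlm k (k - 2 * N) t * Mlm (2 * n - k) (k - 2 * N) t / Mlm (2 * n) 0 t ≤
      C t ^ 2 * t ^ (-(2 : ℝ) * N ^ 2) := by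
  have ht0 : 0 < t := by linarith
  have hnorm := rpow_le_pathSum ht0 n n le_rfl
  have hleft := pathSum_le_C ht (k - N) N
  have hright := pathSum_le_C ht (n - N) (n - k + N)
  have hpos := (rpow_pos_of_pos ht0 ((n : ℝ) ^ 2 - ((n : ℝ) - n) ^ 2 / 2))
  rw [Mlm_eq_pathSum (by omega) (by grind), Mlm_eq_pathSum (by omega) (by grind),
    Mlm_eq_pathSum (by omega) (by simp)]
  rw [show k - N + N = k by omega,
    show ((k - N : ℕ) : ℤ) - N = ((k - 2 * N : ℕ) : ℤ) by omega] at hleft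
  rw [show n - N + (n - k + N) = 2 * n - k by omega,
    show ((n - N : ℕ) : ℤ) - (n - k + N : ℕ) = ((k - 2 * N : ℕ) : ℤ) by omega] at hright
  rw [show n + n = 2 * n by ring, show (n : ℤ) - n = ((0 : ℕ) : ℤ) by simp] at hnorm
  have hC : 0 ≤ C t :=
    tsum_nonneg fun k => mul_nonneg (Nat.cast_nonneg _) (rpow_nonneg ht0.le _)
  rw [div_le_iff₀ (hpos.trans_le hnorm)]
  refine (mul_le_mul hleft hright (pathSum_nonneg ht0 _ _)
    (mul_nonneg (rpow_nonneg ht0.le _) hC)).trans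
    (le_trans ?_ (mul_le_mul_of_nonneg_left hnorm (by positivity)))
  rw [mul_mul_mul_comm, ← rpow_add ht0, mul_comm, ← sq, mul_assoc, ← rpow_add ht0]
  refine mul_le_mul_of_nonneg_left (rpow_le_rpow_of_exponent_le ht.le ?_) (sq_nonneg _)
  have hkn : (k : ℝ) ≤ n := by exact_mod_cast hk
  have hN0 : (0 : ℝ) ≤ N := N.cast_nonneg
  push_cast [show N ≤ k by omega, show N ≤ n by omega, hk]
  nlinarith [mul_nonneg hN0 (sub_nonneg.2 hkn)]

lemma summable_pow_mul_rpow_sq {t : ℝ} (ht : 1 < t) (j : ℕ) :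
    Summable fun N : ℕ => (N : ℝ) ^ j * t ^ (-(2 : ℝ) * (N : ℝ) ^ 2) := by
  have ht0 : 0 < t := by linarith
  have hq := rpow_neg_two_lt_one ht
  have hq0 : 0 ≤ t ^ (-(2 : ℝ)) := rpow_nonneg ht0.le _
  refine (summable_pow_mul_geometric_of_norm_lt_one j
    (r := t ^ (-(2 : ℝ))) (by rwa [norm_of_nonneg hq0])).of_nonneg_of_le (fun N => by positivity)
    fun N => ?_
  rw [← rpow_neg_two_mul ht0]
  have hN : (N : ℝ) ≤ (N : ℝ) ^ 2 := by exact_mod_cast Nat.le_self_pow two_ne_zero N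
  refine mul_le_mul_of_nonneg_left (rpow_le_rpow_of_exponent_le ht.le ?_) (by positivity)
  linarith

/-- Gibbs' inequality, with defect: `q` need not be normalised. -/
lemma neg_mul_log_le {p q : ℝ} (hp : 0 ≤ p) (hq : 0 < q) :
    p * -log p ≤ p * -log q + (q - p) := by
  rcases hp.eq_or_lt with rfl | hp
  · simpa using hq.le
  · have h := log_le_sub_one_of_pos (div_pos hq hp)
    rw [log_div hq.ne' hp.ne'] at h
    have := mul_le_mul_of_nonneg_left h hp.le
    have h2 : p * (q / p - 1) = q - p := by field_simp
    linarith

/-- Bounds on the entanglement entropy for an arbitrary cut: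
`n1 log s + D1(s,t) ≤ S_{n1}(s,t) < n1 log s + D2(t) + D3(t)`. -/
theorem stmt_12 (t : ℝ) (ht : 1 < t) (s : ℕ) (hs : 1 ≤ s)
    (n n1 : ℕ) (hn : 1 ≤ n) (hn1 : 1 ≤ n1) (h : n1 ≤ n) :
    let lam : ℕ → ℝ := fun N' =>
      Mlm n1 (n1 - 2 * N') t * Mlm (2 * n - n1) (n1 - 2 * N') t / Mlm (2 * n) 0 t
    let S := ∑ N' ∈ Finset.range (n1 / 2 + 1),
      lam N' * (((n1 - 2 * N' : ℕ) : ℝ) * Real.log s - Real.log (lam N'))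
    let D1 := -2 * C t ^ 2 * Real.log s * ∑' N' : ℕ, (N' : ℝ) * t ^ (-(2 : ℝ) * N' ^ 2)
    let D2 := Real.log (∑' M' : ℕ, t ^ (-(2 : ℝ) * M' ^ 2))
    let D3 := 2 * C t ^ 2 * Real.log t * ∑' N' : ℕ, (N' : ℝ) ^ 2 * t ^ (-(2 : ℝ) * N' ^ 2)
    (n1 : ℝ) * Real.log s + D1 ≤ S ∧ S < (n1 : ℝ) * Real.log s + D2 + D3 := by
  intro lam S D1 D2 D3
  have ht0 : 0 < t := by linarith
  have hlogs : 0 ≤ log s := log_nonneg (by exact_mod_cast hs)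
  have hlogt : 0 < log t := log_pos ht
  have hnorm : 0 < Mlm (2 * n) 0 t := by
    rw [Mlm_eq_pathSum (Nat.zero_le _) (by simp)]
    refine lt_of_lt_of_le (rpow_pos_of_pos ht0 _) ((rpow_le_pathSum ht0 n n le_rfl).trans_eq ?_)
    rw [sub_self, two_mul, Nat.cast_zero]
  have hM (a b : ℕ) : 0 ≤ Mlm a b t := sum_nonneg fun _ _ => rpow_nonneg ht0.le _
  have hlam0 (N : ℕ) : 0 ≤ lam N := div_nonneg (mul_nonneg (hM _ _) (hM _ _)) hnorm.le
  have hsum : ∑ N ∈ range (n1 / 2 + 1), lam N = 1 := by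
    simp only [lam]
    rw [← sum_div, sum_Mlm_mul ht0 (by omega) ⟨n - n1, by omega⟩,
      show n1 + (2 * n - n1) = 2 * n by omega, div_self hnorm.ne']
  have hlam1 (N : ℕ) (hN : N ∈ range (n1 / 2 + 1)) : lam N ≤ 1 :=
    hsum ▸ single_le_sum (fun i _ => hlam0 i) hN
  have hbound (N : ℕ) (hN : N ∈ range (n1 / 2 + 1)) :
      lam N ≤ C t ^ 2 * t ^ (-(2 : ℝ) * N ^ 2) :=
    Mlm_mul_div_le ht h (by simp at hN; omega)
  have hcast (N : ℕ) (hN : N ∈ range (n1 / 2 + 1)) :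
      ((n1 - 2 * N : ℕ) : ℝ) = n1 - 2 * N := by
    have : 2 * N ≤ n1 := by simp at hN; omega
    push_cast [this]
    rfl
  have hmoment (j : ℕ) : ∑ N ∈ range (n1 / 2 + 1), lam N * (N : ℝ) ^ j ≤
      C t ^ 2 * ∑' N : ℕ, (N : ℝ) ^ j * t ^ (-(2 : ℝ) * N ^ 2) := by
    refine le_trans (sum_le_sum fun N hN =>
      mul_le_mul_of_nonneg_right (hbound N hN) (pow_nonneg N.cast_nonneg j)) ?_
    refine le_trans (le_of_eq ?_) (mul_le_mul_of_nonneg_left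
      ((summable_pow_mul_rpow_sq ht j).sum_le_tsum (range (n1 / 2 + 1))
        fun N _ => mul_nonneg (pow_nonneg N.cast_nonneg j) (rpow_nonneg ht0.le _)) (sq_nonneg _))
    rw [mul_sum]
    exact sum_congr rfl fun N _ => by ring
  have hS : S = n1 * log s - 2 * log s * ∑ N ∈ range (n1 / 2 + 1), lam N * (N : ℝ) ^ 1 +
      ∑ N ∈ range (n1 / 2 + 1), lam N * -log (lam N) := by
    rw [← mul_one ((n1 : ℝ) * log s), ← hsum, mul_sum, mul_sum, ← sum_sub_distrib,
      ← sum_add_distrib]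
    refine sum_congr rfl fun N hN => ?_
    rw [hcast N hN]
    ring
  rw [hS]
  constructor
  · have hent : 0 ≤ ∑ N ∈ range (n1 / 2 + 1), lam N * -log (lam N) :=
      sum_nonneg fun N hN =>
        mul_nonneg (hlam0 N) (neg_nonneg.2 (log_nonpos (hlam0 N) (hlam1 N hN)))
    have := mul_le_mul_of_nonneg_left (hmoment 1) (mul_nonneg zero_le_two hlogs)
    simp only [D1]
    simp only [pow_one] at this ⊢
    linarith
  · set Z := ∑' M' : ℕ, t ^ (-(2 : ℝ) * (M' : ℝ) ^ 2) with hZ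
    have hsummable : Summable fun N : ℕ => t ^ (-(2 : ℝ) * (N : ℝ) ^ 2) := by
      simpa using summable_pow_mul_rpow_sq ht 0
    have hlt : ∑ N ∈ range (n1 / 2 + 1), t ^ (-(2 : ℝ) * (N : ℝ) ^ 2) < Z := by
      refine lt_of_lt_of_le ?_
        (hsummable.sum_le_tsum (range (n1 / 2 + 2)) fun _ _ => rpow_nonneg ht0.le _)
      rw [sum_range_succ _ (n1 / 2 + 1)]
      exact lt_add_of_pos_right _ (rpow_pos_of_pos ht0 _)
    have hZ0 : 0 < Z := hsummable.tsum_pos (fun _ => rpow_nonneg ht0.le _) 0 (rpow_pos_of_pos ht0 _)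
    have hgibbs : ∑ N ∈ range (n1 / 2 + 1), lam N * -log (lam N) <
        log Z + 2 * log t * ∑ N ∈ range (n1 / 2 + 1), lam N * (N : ℝ) ^ 2 := by
      refine lt_of_le_of_lt (sum_le_sum fun N _ =>
        neg_mul_log_le (hlam0 N) (div_pos (rpow_pos_of_pos ht0 (-(2 : ℝ) * (N : ℝ) ^ 2)) hZ0)) ?_
      rw [sum_add_distrib, sum_sub_distrib, hsum, ← sum_div]
      have h1 : (∑ N ∈ range (n1 / 2 + 1), t ^ (-(2 : ℝ) * (N : ℝ) ^ 2)) / Z < 1 :=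
        (div_lt_one hZ0).2 hlt
      have h2 : ∑ N ∈ range (n1 / 2 + 1), lam N * -log (t ^ (-(2 : ℝ) * (N : ℝ) ^ 2) / Z) =
          log Z + 2 * log t * ∑ N ∈ range (n1 / 2 + 1), lam N * (N : ℝ) ^ 2 := by
        rw [← mul_one (log Z), ← hsum, mul_sum, mul_sum, ← sum_add_distrib]
        refine sum_congr rfl fun N _ => ?_
        rw [log_div (rpow_pos_of_pos ht0 _).ne' hZ0.ne', log_rpow ht0]
        ring
      linarith
    have hmom := mul_le_mul_of_nonneg_left (hmoment 2) (mul_nonneg zero_le_two hlogt.le)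
    have hneg : 0 ≤ 2 * log s * ∑ N ∈ range (n1 / 2 + 1), lam N * (N : ℝ) ^ 1 :=
      mul_nonneg (mul_nonneg zero_le_two hlogs)
        (sum_nonneg fun N _ => mul_nonneg (hlam0 N) (by positivity))
    simp only [D2, D3]
    linarith
end
end

section
/- Let t > 1 and κ > 0 be real numbers, s ≥ 1 an integer, let n ≥ 1 and 1 ≤ n1 ≤ n be integers, and set λ_{N'} := M_{n1,n1−2N'}(t) · M_{2n−n1,n1−2N'}(t) / M_{2n,0}(t) for 0 ≤ N' ≤ ⌊n1/2⌋. Then Σ_{N'=0}^{⌊n1/2⌋} λ_{N'}^κ · s^{−2(1−κ)N'} < C(t)^{2κ} · D4(s,t,κ), where D4(s,t,κ) := Σ_{N'=0}^∞ s^{−2(1−κ)N'} t^{−2κN'²}. -/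
noncomputable section

open Finset

/-- For each down step (`false`), the number of up steps (`true`) after it; for a path of up and
down steps these are the row lengths of the Young diagram between it and the highest path with
the same number of steps of each kind. -/
def upsAfterDowns : List Bool → Multiset ℕ
  | [] => 0
  | true :: l => upsAfterDowns l
  | false :: l => l.count true ::ₘ upsAfterDowns l

lemma le_count_of_mem_upsAfterDowns {l : List Bool} {x : ℕ} (hx : x ∈ upsAfterDowns l) :
    x ≤ l.count true := by
  induction l with
  | nil => simp [upsAfterDowns] at hx
  | cons b l ih =>
    cases b
    · rcases Multiset.mem_cons.1 hx with rfl | hx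
      · simp
      · simpa using ih hx
    · have := ih hx
      simp; omega

lemma card_upsAfterDowns (l : List Bool) : (upsAfterDowns l).card = l.count false := by
  induction l with
  | nil => rfl
  | cons b l ih => cases b <;> simp [upsAfterDowns, ih]

lemma upsAfterDowns_injective {l l' : List Bool} (hu : l.count true = l'.count true)
    (hlen : l.length = l'.length) (h : upsAfterDowns l = upsAfterDowns l') : l = l' := by
  induction l generalizing l' with
  | nil => simpa using hlen.symm
  | cons b l ih =>
    cases l' with
    | nil => simp at hlen
    | cons b' l' =>
      have hlen' : l.length = l'.length := by simpa using hlen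
      cases b <;> cases b'
      · have hu' : l.count true = l'.count true := by simpa using hu
        simp only [upsAfterDowns, hu', Multiset.cons_inj_right] at h
        rw [ih hu' hlen' h]
      · have hmem : l.count true ∈ upsAfterDowns l' := by
          have : upsAfterDowns (true :: l') = upsAfterDowns l' := rfl
          rw [← this, ← h]
          exact Multiset.mem_cons_self _ _
        have := le_count_of_mem_upsAfterDowns hmem
        simp at hu
        omega
      · have hmem : l'.count true ∈ upsAfterDowns l := by
          have : upsAfterDowns (true :: l) = upsAfterDowns l := rfl
          rw [← this, h]
          exact Multiset.mem_cons_self _ _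
        have := le_count_of_mem_upsAfterDowns hmem
        simp at hu
        omega
      · have hu' : l.count true = l'.count true := by simpa using hu
        rw [ih hu' hlen' h]

lemma Multiset.eq_of_card_eq_of_filter_ne_eq {α : Type*} [DecidableEq α] {s s' : Multiset α}
    (a : α) (hc : s.card = s'.card) (h : s.filter (· ≠ a) = s'.filter (· ≠ a)) : s = s' := by
  have e := congrArg Multiset.card (Multiset.filter_add_not (· = a) s)
  have e' := congrArg Multiset.card (Multiset.filter_add_not (· = a) s')
  rw [Multiset.card_add] at e e'
  rw [← Multiset.filter_add_not (· = a) s, ← Multiset.filter_add_not (· = a) s']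
  simp only [ne_eq] at h
  rw [h] at e ⊢
  simp only [Multiset.filter_eq'] at e e' ⊢
  simp only [Multiset.card_replicate] at e e'
  have : s.count a = s'.count a := by omega
  rw [this]

lemma card_filter_sum_upsAfterDowns_le {L : ℕ} (S : Finset (Fin L → Bool)) (u k : ℕ)
    (hS : ∀ w ∈ S, (List.ofFn w).count true = u) :
    #{w ∈ S | (upsAfterDowns (List.ofFn w)).sum = k} ≤ P k := by
  classical
  unfold P
  rw [← Finset.card_univ]
  refine Finset.card_le_card_of_injOn
    (fun w => if hw : (upsAfterDowns (List.ofFn w)).sum = k then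
      Nat.Partition.ofSums k _ hw else default) (fun _ _ => by simp) ?_
  intro w hw w' hw' hww
  simp only [coe_filter, Set.mem_ofPred_eq] at hw hw'
  simp only [hw.2, hw'.2, dif_pos] at hww
  have hparts := congrArg Nat.Partition.parts hww
  simp only [Nat.Partition.ofSums_parts] at hparts
  have hu : (List.ofFn w).count true = (List.ofFn w').count true := by
    rw [hS w hw.1, hS w' hw'.1]
  have h1 := List.count_true_add_count_false (List.ofFn w)
  have h2 := List.count_true_add_count_false (List.ofFn w')
  simp only [List.length_ofFn] at h1 h2
  refine List.ofFn_injective (upsAfterDowns_injective hu (by simp) ?_)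
  refine Multiset.eq_of_card_eq_of_filter_ne_eq 0 ?_ hparts
  rw [card_upsAfterDowns, card_upsAfterDowns]
  omega

lemma height_succ {L : ℕ} (w : Fin (L + 1) → Bool) (i : ℕ) :
    height w (i + 1) = (if w 0 then 1 else -1) + height (Fin.tail w) i := by
  simp [height, Finset.sum_filter, Fin.sum_univ_succ, Fin.tail]
  rfl

lemma height_zero {L : ℕ} (w : Fin L → Bool) : height w 0 = 0 := by
  simp [height]

lemma area_succ {L : ℕ} (w : Fin (L + 1) → Bool) :
    area w = (if w 0 then 1 else -1) * (L + 1 / 2) + area (Fin.tail w) := by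
  unfold area
  have key : ∀ e : ℤ, (∀ i, height w (i + 1) = e + height (Fin.tail w) i) →
      ∑ i ∈ Finset.range (L + 1), ((height w i + height w (i + 1) : ℤ) : ℝ) =
      e * (2 * L + 1) + ∑ i ∈ Finset.range L,
        ((height (Fin.tail w) i + height (Fin.tail w) (i + 1) : ℤ) : ℝ) := by
    intro e he
    rw [Finset.sum_range_succ']
    simp only [he, height_zero]
    have : ∀ i, (((e + height (Fin.tail w) i + (e + height (Fin.tail w) (i + 1)) : ℤ)) : ℝ) =
        2 * e + ((height (Fin.tail w) i + height (Fin.tail w) (i + 1) : ℤ) : ℝ) := by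
      intro i; push_cast; ring
    simp only [this, Finset.sum_add_distrib]
    simp
    ring
  rw [key _ (height_succ w)]
  split_ifs <;> push_cast <;> ring

lemma area_eq {L : ℕ} (w : Fin L → Bool) :
    area w = ((List.ofFn w).count true : ℝ) ^ 2
      - (((List.ofFn w).count true : ℝ) - (List.ofFn w).count false) ^ 2 / 2
      - 2 * (upsAfterDowns (List.ofFn w)).sum := by
  induction L with
  | zero => simp [area, upsAfterDowns]
  | succ L ih =>
    rw [area_succ, ih, List.ofFn_succ]
    have hL := List.count_true_add_count_false (List.ofFn (Fin.tail w))
    have htail : (fun i : Fin L => w i.succ) = Fin.tail w := rfl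
    rw [htail]
    rw [List.length_ofFn] at hL
    have hL' : (L : ℝ) = (List.ofFn (Fin.tail w)).count true
      + (List.ofFn (Fin.tail w)).count false := by exact_mod_cast hL.symm
    rw [hL']
    cases w 0 <;> simp [upsAfterDowns] <;> ring

lemma count_true_ofFn {L : ℕ} (w : Fin L → Bool) :
    (List.ofFn w).count true = #{j | w j = true} := by
  induction L with
  | zero => simp
  | succ L ih =>
    rw [List.ofFn_succ, List.count_cons, ih, Fin.card_filter_univ_succ]
    cases w 0 <;> simp

lemma P_pos (k : ℕ) : 0 < P k := Fintype.card_pos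

lemma sum_P_mul_pow_le {x : ℝ} (hx : 0 ≤ x) (N : ℕ) :
    ∑ k ∈ range N, (P k : ℝ) * x ^ k ≤ ∏ i : Fin N, ∑ j ∈ range N, (x ^ ((i : ℕ) + 1)) ^ j := by
  classical
  rw [Finset.prod_univ_sum]
  let S : Finset (Σ k, Nat.Partition k) := (range N).sigma fun _ => univ
  let φ : (Σ k, Nat.Partition k) → (Fin N → ℕ) := fun p i => p.2.parts.count ((i : ℕ) + 1)
  have hsub : ∀ p ∈ S, p.2.parts.toFinset ⊆ 
      univ.map ((Fin.valEmbedding (n := N)).trans (addRightEmbedding 1)) := by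
    intro p hp m hm
    have h1 := p.2.parts_pos (Multiset.mem_toFinset.1 hm)
    have h2 := p.2.le_of_mem_parts (Multiset.mem_toFinset.1 hm)
    have h3 : p.1 < N := by simpa [S] using hp
    exact Finset.mem_map.2 ⟨⟨m - 1, by omega⟩, mem_univ _, by simp; omega⟩
  have hsum : ∀ p ∈ S, ∑ i : Fin N, φ p i * ((i : ℕ) + 1) = p.1 := by
    intro p hp
    conv_rhs => rw [← p.2.parts_sum, Finset.sum_multiset_count_of_subset _ _ (hsub p hp)]
    simp [φ]
  have hinj : Set.InjOn φ S := by
    intro p hp q hq hpq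
    have h1 : p.1 = q.1 := by rw [← hsum p hp, ← hsum q hq, hpq]
    have hparts : p.2.parts = q.2.parts := by
      ext m
      rcases Nat.eq_zero_or_pos m with rfl | hm
      · rw [Multiset.count_eq_zero_of_notMem, Multiset.count_eq_zero_of_notMem]
        · exact fun h => absurd (q.2.parts_pos h) (by simp)
        · exact fun h => absurd (p.2.parts_pos h) (by simp)
      · by_cases hmN : m ≤ N
        · have := congrFun hpq ⟨m - 1, by omega⟩
          simpa [φ, Nat.sub_add_cancel hm] using this
        · have h3 : p.1 < N := by simpa [S] using hp
          rw [Multiset.count_eq_zero_of_notMem, Multiset.count_eq_zero_of_notMem]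
          · exact fun h => by have := q.2.le_of_mem_parts h; omega
          · exact fun h => by have := p.2.le_of_mem_parts h; omega
    obtain ⟨k, p⟩ := p
    obtain ⟨k', q⟩ := q
    obtain rfl : k = k' := h1
    exact congrArg (Sigma.mk k) (Nat.Partition.ext hparts)
  calc ∑ k ∈ range N, (P k : ℝ) * x ^ k
      = ∑ p ∈ S, x ^ p.1 := by
        rw [Finset.sum_sigma]
        simp [P]
    _ = ∑ p ∈ S, ∏ i : Fin N, (x ^ ((i : ℕ) + 1)) ^ (φ p i) := by
        refine Finset.sum_congr rfl fun p hp => ?_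
        conv_lhs => rw [← hsum p hp]
        rw [← Finset.prod_pow_eq_pow_sum]
        refine Finset.prod_congr rfl fun i _ => ?_
        rw [← pow_mul, mul_comm]
    _ = ∑ f ∈ S.image φ, ∏ i : Fin N, (x ^ ((i : ℕ) + 1)) ^ (f i) := by
        rw [Finset.sum_image hinj]
    _ ≤ _ := by
        refine Finset.sum_le_sum_of_subset_of_nonneg ?_ fun _ _ _ => by positivity
        intro f hf
        obtain ⟨p, hp, rfl⟩ := Finset.mem_image.1 hf
        rw [Fintype.mem_piFinset]
        intro i
        have h3 : p.1 < N := by simpa [S] using hp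
        have h4 := Finset.single_le_sum (f := fun i : Fin N => φ p i * ((i : ℕ) + 1))
          (fun _ _ => Nat.zero_le _) (mem_univ i)
        rw [hsum p hp] at h4
        rw [mem_range]
        have : φ p i ≤ φ p i * ((i : ℕ) + 1) := Nat.le_mul_of_pos_right _ (by omega)
        omega

lemma geom_sum_le_exp {x : ℝ} (hx : 0 ≤ x) (hx1 : x < 1) (N i : ℕ) :
    ∑ j ∈ range N, (x ^ (i + 1)) ^ j ≤ Real.exp (x ^ i * (1 - x)⁻¹) := by
  have hy : x ^ (i + 1) ≤ x := pow_le_of_le_one hx hx1.le (by omega)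
  have hy0 : 0 ≤ x ^ (i + 1) := by positivity
  have h1 : ∑ j ∈ range N, (x ^ (i + 1)) ^ j ≤ (1 - x ^ (i + 1))⁻¹ := by
    rw [← tsum_geometric_of_lt_one hy0 (by linarith)]
    exact Summable.sum_le_tsum _ (fun _ _ => by positivity)
      (summable_geometric_of_lt_one hy0 (by linarith))
  have h2 : (1 - x ^ (i + 1))⁻¹ ≤ x ^ i * (1 - x)⁻¹ + 1 := by
    have hpos : 0 < 1 - x ^ (i + 1) := by linarith
    have hpos' : 0 < 1 - x := by linarith
    have h3 : (1 - x ^ (i + 1))⁻¹ = x ^ (i + 1) * (1 - x ^ (i + 1))⁻¹ + 1 := by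
      field_simp; ring
    rw [h3]
    have h4 : (1 - x ^ (i + 1))⁻¹ ≤ (1 - x)⁻¹ := inv_anti₀ hpos' (by linarith)
    have h5 : x ^ (i + 1) ≤ x ^ i := pow_le_pow_of_le_one hx hx1.le (by omega)
    have h6 : 0 ≤ (1 - x ^ (i + 1))⁻¹ := by positivity
    gcongr
  exact h1.trans (h2.trans (Real.add_one_le_exp _))

lemma summable_P_mul_pow {x : ℝ} (hx : 0 ≤ x) (hx1 : x < 1) :
    Summable fun k : ℕ => (P k : ℝ) * x ^ k := by
  have hpos' : 0 < 1 - x := by linarith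
  refine summable_of_sum_range_le (c := Real.exp ((1 - x)⁻¹ * (1 - x)⁻¹))
    (fun _ => by positivity) fun N => ?_
  refine (sum_P_mul_pow_le hx N).trans ?_
  calc ∏ i : Fin N, ∑ j ∈ range N, (x ^ ((i : ℕ) + 1)) ^ j
      ≤ ∏ i : Fin N, Real.exp (x ^ (i : ℕ) * (1 - x)⁻¹) :=
        Finset.prod_le_prod (fun _ _ => by positivity) fun i _ => geom_sum_le_exp hx hx1 N i
    _ = Real.exp ((∑ i ∈ range N, x ^ i) * (1 - x)⁻¹) := by
        rw [← Real.exp_sum, Fin.sum_univ_eq_sum_range (fun i => x ^ i * (1 - x)⁻¹),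
          Finset.sum_mul]
    _ ≤ _ := by
        have : ∑ i ∈ range N, x ^ i ≤ (1 - x)⁻¹ := by
          rw [← tsum_geometric_of_lt_one hx hx1]
          exact Summable.sum_le_tsum _ (fun _ _ => by positivity)
            (summable_geometric_of_lt_one hx hx1)
        gcongr

lemma summable_C {t : ℝ} (ht : 1 < t) :
    Summable fun k : ℕ => (P k : ℝ) * t ^ (-(2 : ℝ) * k) := by
  have h0 : 0 < t := by linarith
  have h1 : t ^ (-(2 : ℝ)) < 1 := Real.rpow_lt_one_of_one_lt_of_neg ht (by norm_num)
  refine (summable_P_mul_pow (by positivity) h1).congr fun k => ?_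
  rw [Real.rpow_mul h0.le, Real.rpow_natCast]

lemma C_pos {t : ℝ} (ht : 1 < t) : 0 < C t := by
  have h0 : 0 < t := by linarith
  refine (summable_C ht).tsum_pos (fun k => by positivity) 0 ?_
  have := P_pos 0
  positivity

lemma M_nonneg (a b : ℕ) {t : ℝ} (ht : 0 ≤ t) : 0 ≤ M a b t :=
  Finset.sum_nonneg fun _ _ => Real.rpow_nonneg ht _

lemma M_le (a b : ℕ) {t : ℝ} (ht : 1 < t) :
    M a b t ≤ t ^ (((a : ℝ) + b) ^ 2 - (b : ℝ) ^ 2 / 2) * C t := by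
  classical
  have h0 : 0 < t := by linarith
  have hcount : ∀ w ∈ DyckSet a b, (List.ofFn w).count true = a + b := by
    intro w hw
    rw [count_true_ofFn]
    exact (Finset.mem_filter.1 hw).2.1
  have harea : ∀ w ∈ DyckSet a b, t ^ area w = t ^ (((a : ℝ) + b) ^ 2 - (b : ℝ) ^ 2 / 2) *
      t ^ (-(2 : ℝ) * ((upsAfterDowns (List.ofFn w)).sum : ℕ)) := by
    intro w hw
    have hu := hcount w hw
    have hd := List.count_true_add_count_false (List.ofFn w)
    rw [List.length_ofFn, hu] at hd
    have hd' : (List.ofFn w).count false = a := by omega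
    rw [← Real.rpow_add h0, area_eq, hu, hd']
    congr 1
    push_cast
    ring
  unfold M
  rw [Finset.sum_congr rfl harea, ← Finset.mul_sum]
  gcongr
  rw [Finset.sum_comp (fun k : ℕ => t ^ (-(2 : ℝ) * k))
    (fun w => (upsAfterDowns (List.ofFn w)).sum)]
  calc _ ≤ ∑ k ∈ (DyckSet a b).image fun w => (upsAfterDowns (List.ofFn w)).sum,
        (P k : ℝ) * t ^ (-(2 : ℝ) * k) := by
        refine Finset.sum_le_sum fun k _ => ?_
        rw [nsmul_eq_mul]
        gcongr
        exact card_filter_sum_upsAfterDowns_le _ _ k hcount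
    _ ≤ C t := (summable_C ht).sum_le_tsum _ fun _ _ => by positivity

lemma upsAfterDowns_replicate_append (m : ℕ) (l : List Bool) :
    upsAfterDowns (List.replicate m true ++ l) = upsAfterDowns l := by
  induction m with
  | zero => simp
  | succ m ih => simpa [List.replicate_succ, upsAfterDowns] using ih

lemma upsAfterDowns_replicate_false (m : ℕ) :
    upsAfterDowns (List.replicate m false) = Multiset.replicate m 0 := by
  induction m with
  | zero => rfl
  | succ m ih => simp [List.replicate_succ, upsAfterDowns, ih, List.count_replicate]

lemma height_add_one {L : ℕ} (w : Fin L → Bool) {i : ℕ} (hi : i < L) :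
    height w (i + 1) = height w i + if w ⟨i, hi⟩ then 1 else -1 := by
  unfold height
  have : (univ.filter fun j : Fin L => (j : ℕ) < i + 1) =
      insert ⟨i, hi⟩ (univ.filter fun j : Fin L => (j : ℕ) < i) := by
    ext j
    simp only [mem_filter, mem_univ, true_and, mem_insert, Fin.ext_iff]
    omega
  rw [this, Finset.sum_insert (by simp), add_comm]

lemma rpow_sq_le_M (n : ℕ) {t : ℝ} (ht : 0 < t) : t ^ ((n : ℝ) ^ 2) ≤ M n 0 t := by
  let w : Fin (2 * n + 0) → Bool := fun i => decide ((i : ℕ) < n)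
  have hlist : List.ofFn w = List.replicate n true ++ List.replicate n false := by
    refine List.ext_getElem (by simp; omega) fun i h1 h2 => ?_
    simp only [List.getElem_ofFn, w]
    by_cases hi : i < n
    · rw [List.getElem_append_left (by simpa using hi)]
      simpa using hi
    · rw [List.getElem_append_right (by simpa using hi)]
      simpa using hi
  have hheight : ∀ i ≤ 2 * n + 0, height w i = if i ≤ n then (i : ℤ) else 2 * n - i := by
    intro i
    induction i with
    | zero => simp [height_zero]
    | succ i ih =>
      intro hi
      rw [height_add_one w (by omega), ih (by omega)]
      simp only [w, decide_eq_true_eq]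
      split_ifs <;> push_cast <;> omega
  have hw : w ∈ DyckSet n 0 := by
    refine Finset.mem_filter.2 ⟨mem_univ _, ?_, fun i hi => ?_⟩
    · rw [← count_true_ofFn, hlist]
      simp [List.count_replicate]
    · rw [hheight i hi]
      split_ifs <;> omega
  have harea : area w = (n : ℝ) ^ 2 := by
    rw [area_eq, hlist, upsAfterDowns_replicate_append, upsAfterDowns_replicate_false]
    simp [List.count_replicate]
  rw [← harea]
  exact Finset.single_le_sum (f := fun w => t ^ area w)
    (fun _ _ => Real.rpow_nonneg ht.le _) hw

lemma M_mul_M_div_le {t : ℝ} (ht : 1 < t) {n n1 N : ℕ} (h : n1 ≤ n) (hN : 2 * N ≤ n1) :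
    Mlm n1 (n1 - 2 * N) t * Mlm (2 * n - n1) (n1 - 2 * N) t / Mlm (2 * n) 0 t
      ≤ C t ^ 2 * t ^ (-(2 : ℝ) * N ^ 2) := by
  have h0 : 0 < t := by linarith
  have hC := C_pos ht
  unfold Mlm
  have e1 : (n1 - (n1 - 2 * N)) / 2 = N := by omega
  have e2 : (2 * n - n1 - (n1 - 2 * N)) / 2 = n - n1 + N := by omega
  have e3 : (2 * n - 0) / 2 = n := by omega
  rw [e1, e2, e3, div_le_iff₀ ((Real.rpow_pos_of_pos h0 _).trans_le (rpow_sq_le_M n h0))]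
  calc M N (n1 - 2 * N) t * M (n - n1 + N) (n1 - 2 * N) t
      ≤ (t ^ (((N : ℝ) + (n1 - 2 * N : ℕ)) ^ 2 - ((n1 - 2 * N : ℕ) : ℝ) ^ 2 / 2) * C t) *
        (t ^ ((((n - n1 + N : ℕ) : ℝ) + (n1 - 2 * N : ℕ)) ^ 2
          - ((n1 - 2 * N : ℕ) : ℝ) ^ 2 / 2) * C t) := by
        gcongr
        · exact M_nonneg _ _ h0.le
        · exact M_le _ _ ht
        · exact M_le _ _ ht
    _ = C t ^ 2 * t ^ (-(2 : ℝ) * N ^ 2 + (n : ℝ) ^ 2 - 2 * N * (n - n1)) := by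
        rw [mul_mul_mul_comm, ← Real.rpow_add h0, mul_comm, ← sq]
        congr 2
        push_cast [Nat.cast_sub hN, Nat.cast_sub h]
        ring
    _ ≤ C t ^ 2 * t ^ (-(2 : ℝ) * N ^ 2 + (n : ℝ) ^ 2) := by
        have h' : (n1 : ℝ) ≤ n := by exact_mod_cast h
        have : (0 : ℝ) ≤ 2 * N * (n - n1) := mul_nonneg (by positivity) (by linarith)
        gcongr
        · exact ht.le
        · linarith
    _ = C t ^ 2 * t ^ (-(2 : ℝ) * N ^ 2) * t ^ ((n : ℝ) ^ 2) := by
        rw [Real.rpow_add h0, mul_assoc]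
    _ ≤ _ := by
        gcongr
        exact rpow_sq_le_M n h0

lemma summable_rpow_mul_rpow_neg_sq {s t κ : ℝ} (hs : 0 < s) (ht : 1 < t) (hκ : 0 < κ) :
    Summable fun N : ℕ =>
      s ^ (-(2 : ℝ) * (1 - κ) * N) * t ^ (-(2 : ℝ) * κ * (N : ℝ) ^ 2) := by
  have h0 : 0 < t := by linarith
  have hlog : 0 < Real.log t := Real.log_pos ht
  set A := -(2 : ℝ) * (1 - κ) * Real.log s with hA
  set B := 2 * κ * Real.log t with hB
  have hBpos : 0 < B := by positivity
  have hterm : ∀ N : ℕ, s ^ (-(2 : ℝ) * (1 - κ) * N) * t ^ (-(2 : ℝ) * κ * (N : ℝ) ^ 2) =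
      Real.exp (A * N - B * (N : ℝ) ^ 2) := by
    intro N
    rw [Real.rpow_def_of_pos hs, Real.rpow_def_of_pos h0, ← Real.exp_add]
    congr 1
    rw [hA, hB]
    ring
  simp only [hterm]
  refine Summable.of_nonneg_of_le (fun _ => (Real.exp_pos _).le) (fun N => ?_)
    (Real.summable_exp_neg_nat.mul_left (Real.exp ((A + 1) ^ 2 / (4 * B))))
  rw [← Real.exp_add, Real.exp_le_exp]
  have : (A + 1) ^ 2 / (4 * B) + -(N : ℝ) - (A * N - B * (N : ℝ) ^ 2) =
      ((A + 1) - 2 * B * N) ^ 2 / (4 * B) := by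
    field_simp
    ring
  have h2 : 0 ≤ ((A + 1) - 2 * B * N) ^ 2 / (4 * B) := by positivity
  linarith

/-- Bound for the Rényi sum:
`Σ_{N'} λ_{N'}^κ s^{-2(1-κ)N'} < C(t)^{2κ} D4(s,t,κ)`. -/
theorem stmt_13 (t κ : ℝ) (ht : 1 < t) (hκ : 0 < κ) (s : ℕ) (hs : 1 ≤ s)
    (n n1 : ℕ) (hn : 1 ≤ n) (hn1 : 1 ≤ n1) (h : n1 ≤ n) :
    let lam : ℕ → ℝ := fun N' =>
      Mlm n1 (n1 - 2 * N') t * Mlm (2 * n - n1) (n1 - 2 * N') t / Mlm (2 * n) 0 t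
    ∑ N' ∈ Finset.range (n1 / 2 + 1), lam N' ^ κ * (s : ℝ) ^ (-(2 : ℝ) * (1 - κ) * N')
      < C t ^ (2 * κ) *
        ∑' N' : ℕ, (s : ℝ) ^ (-(2 : ℝ) * (1 - κ) * N') * t ^ (-(2 : ℝ) * κ * N' ^ 2) := by
  intro lam
  have h0 : 0 < t := by linarith
  have hs0 : (0 : ℝ) < s := by exact_mod_cast hs
  have hC := C_pos ht
  have hsummable := summable_rpow_mul_rpow_neg_sq hs0 ht hκ
  have hlam : ∀ N' ∈ Finset.range (n1 / 2 + 1),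
      lam N' ^ κ * (s : ℝ) ^ (-(2 : ℝ) * (1 - κ) * N') ≤ C t ^ (2 * κ) *
        ((s : ℝ) ^ (-(2 : ℝ) * (1 - κ) * N') * t ^ (-(2 : ℝ) * κ * (N' : ℝ) ^ 2)) := by
    intro N' hN'
    have hN : 2 * N' ≤ n1 := by have := mem_range.1 hN'; omega
    have hnonneg : 0 ≤ lam N' :=
      div_nonneg (mul_nonneg (M_nonneg _ _ h0.le) (M_nonneg _ _ h0.le)) (M_nonneg _ _ h0.le)
    have hle : lam N' ^ κ ≤ C t ^ (2 * κ) * t ^ (-(2 : ℝ) * κ * (N' : ℝ) ^ 2) := by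
      refine (Real.rpow_le_rpow hnonneg (M_mul_M_div_le ht h hN) hκ.le).trans_eq ?_
      rw [Real.mul_rpow (by positivity) (by positivity), ← Real.rpow_mul h0.le,
        ← Real.rpow_natCast, ← Real.rpow_mul hC.le]
      congr 2
      ring
    calc _ ≤ C t ^ (2 * κ) * t ^ (-(2 : ℝ) * κ * (N' : ℝ) ^ 2) *
          (s : ℝ) ^ (-(2 : ℝ) * (1 - κ) * N') := by gcongr
      _ = _ := by ring
  refine (Finset.sum_le_sum hlam).trans_lt ?_
  rw [← Finset.mul_sum]
  refine mul_lt_mul_of_pos_left ?_ (by positivity)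
  refine lt_of_lt_of_le ?_ (hsummable.sum_le_tsum (Finset.range (n1 / 2 + 2))
    fun _ _ => by positivity)
  rw [Finset.sum_range_succ _ (n1 / 2 + 1)]
  exact lt_add_of_pos_right _ (by positivity)
end
end
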